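/- Let φ ∈ C_0^∞ of the unit ball of ℝⁿ, ∫φ = 1, P_t f = φ_t * f with φ_t(x) = t^{-n}φ(x/t). For F ∈ C_0^∞(ℝⁿ) and k ≥ 1 define β_k(x,t) = ( ⨍_{|x−y|≤Ct} |F(y) − F(x) − (y−x)·P_{2^{-k}t}(∇F)(x)|² / t² dy )^{1/2}. Then ∫₀^∞∫_{ℝⁿ} β_k(x,t)² dx dt/t ≤ C k ‖∇F‖²_{L²(ℝⁿ)}. -/

import Mathlib

open MeasureTheory Set
open scoped FourierTransform SchwartzMap Convolution LineDeriv

section core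
variable {V : Type*} [NormedAddCommGroup V] [InnerProductSpace ℝ V] [FiniteDimensional ℝ V]
  [MeasurableSpace V] [BorelSpace V]

/-- Plancherel for Schwartz functions in `lintegral` form. -/
lemma aux_plancherel (f : 𝓢(V, ℂ)) :
    ∫⁻ ξ, ‖𝓕 f ξ‖ₑ ^ 2 = ∫⁻ x, ‖f x‖ₑ ^ 2 := by
  have key : ∀ g : 𝓢(V, ℂ), ∫⁻ x, ‖g x‖ₑ ^ 2 = ENNReal.ofReal (∫ x, ‖g x‖ ^ 2) := by
    intro g
    rw [ofReal_integral_eq_lintegral_ofReal]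
    · congr with x
      rw [← ofReal_norm, ENNReal.ofReal_pow (norm_nonneg _)]
    · exact (g.memLp 2 volume).integrable_norm_pow (by norm_num)
    · exact Filter.Eventually.of_forall fun x => by positivity
  rw [key, key, SchwartzMap.integral_norm_sq_fourier]

lemma aux_fourier_shift (f : 𝓢(V, ℂ)) (w ξ : V) :
    𝓕 (f.compSubConstCLM ℂ (-w)) ξ
      = Complex.exp (2 * Real.pi * inner ℝ w ξ * Complex.I) * 𝓕 f ξ := by
  have := congrFun (VectorFourier.fourierIntegral_comp_add_right Real.fourierChar volume
    (innerₗ V) (f : V → ℂ) w) ξ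
  rw [SchwartzMap.fourier_coe, SchwartzMap.fourier_coe]
  have h2 : (⇑(f.compSubConstCLM ℂ (-w)) : V → ℂ) = f ∘ fun v => v + w := by
    ext x; simp
  rw [h2]
  change VectorFourier.fourierIntegral Real.fourierChar volume (innerₗ V) (f ∘ fun v => v + w) ξ = _
  rw [this]
  simp only [Circle.smul_def, Real.fourierChar_apply, smul_eq_mul, innerₗ_apply_apply]
  push_cast
  rfl

lemma aux_fourier_dilate (φ : V → ℂ) {r : ℝ} (hr : 0 < r) (ξ : V) :
    𝓕 (fun x => ((r⁻¹ ^ Module.finrank ℝ V : ℝ) : ℂ) * φ (r⁻¹ • x)) ξ = 𝓕 φ (r • ξ) := by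
  rw [Real.fourier_eq, Real.fourier_eq]
  have := Measure.integral_comp_smul (volume : Measure V)
    (fun y => (Real.fourierChar (-inner ℝ y (r • ξ))) • φ y) r⁻¹
  have h2 : ∀ x : V, inner ℝ (r⁻¹ • x) (r • ξ) = (inner ℝ x ξ : ℝ) := by
    intro x
    rw [inner_smul_left, inner_smul_right]
    simp; field_simp
  simp only [h2] at this
  have h3 : ∀ x : V, Real.fourierChar (-inner ℝ x ξ) •
      (((r⁻¹ ^ Module.finrank ℝ V : ℝ) : ℂ) * φ (r⁻¹ • x))
      = (r⁻¹ ^ Module.finrank ℝ V : ℝ) • (Real.fourierChar (-inner ℝ x ξ) • φ (r⁻¹ • x)) := by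
    intro x
    simp only [Circle.smul_def, smul_eq_mul, Complex.real_smul]; ring
  simp only [h3]
  rw [integral_smul, this, smul_smul, abs_of_pos (by positivity)]
  rw [mul_inv_cancel₀ (by positivity), one_smul]

/-- The multiplier. -/
noncomputable def auxM (φ : V → ℂ) (r : ℝ) (w ξ : V) : ℂ :=
  Complex.exp (2 * Real.pi * inner ℝ w ξ * Complex.I) - 1
    - 2 * Real.pi * Complex.I * inner ℝ w ξ * 𝓕 φ (r • ξ)

lemma aux_core1 (φ F : V → ℂ) (hφ : ContDiff ℝ (⊤ : ℕ∞) φ) (hφc : HasCompactSupport φ)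
    (hF : ContDiff ℝ (⊤ : ℕ∞) F) (hFc : HasCompactSupport F) {r : ℝ} (hr : 0 < r) (w : V) :
    ∫⁻ x, ‖F (x + w) - F x - ∫ z, (((r⁻¹ ^ Module.finrank ℝ V : ℝ) : ℂ) * φ (r⁻¹ • (x - z)))
        * fderiv ℝ F z w‖ₑ ^ 2
      = ∫⁻ ξ, ‖auxM φ r w ξ‖ₑ ^ 2 * ‖𝓕 F ξ‖ₑ ^ 2 := by
  set f : 𝓢(V, ℂ) := hFc.toSchwartzMap hF with hf
  have hgc : HasCompactSupport (fun x => ((r⁻¹ ^ Module.finrank ℝ V : ℝ) : ℂ) * φ (r⁻¹ • x)) := by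
    apply HasCompactSupport.mul_left
    exact hφc.comp_homeomorph (Homeomorph.smulOfNeZero r⁻¹ (by positivity))
  have hg : ContDiff ℝ (⊤ : ℕ∞)
      (fun x => ((r⁻¹ ^ Module.finrank ℝ V : ℝ) : ℂ) * φ (r⁻¹ • x)) := by
    apply ContDiff.mul contDiff_const
    exact hφ.comp (contDiff_const_smul _)
  set g : 𝓢(V, ℂ) := hgc.toSchwartzMap hg with hg'
  set S : 𝓢(V, ℂ) := f.compSubConstCLM ℂ (-w) - f
    - SchwartzMap.convolution (ContinuousLinearMap.mul ℂ ℂ) g (∂_{w} f) with hS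
  have h1 : ∀ x, S x = F (x + w) - F x - ∫ z, (((r⁻¹ ^ Module.finrank ℝ V : ℝ) : ℂ)
      * φ (r⁻¹ • (x - z))) * fderiv ℝ F z w := by
    intro x
    simp only [hS, sub_apply, SchwartzMap.convolution_apply,
      SchwartzMap.compSubConstCLM_apply, sub_neg_eq_add]
    rw [convolution_eq_swap]
    simp only [SchwartzMap.lineDerivOp_apply_eq_fderiv, ContinuousLinearMap.mul_apply']
    rfl
  have h2 : ∀ ξ, 𝓕 S ξ = auxM φ r w ξ * 𝓕 F ξ := by
    intro ξ
    have e1 : 𝓕 S = 𝓕 (f.compSubConstCLM ℂ (-w)) - 𝓕 f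
       - 𝓕 (SchwartzMap.convolution (ContinuousLinearMap.mul ℂ ℂ) g (∂_{w} f)) := by
      rw [hS]
      have := fun a b : 𝓢(V, ℂ) => map_sub (FourierTransform.fourierCLM ℂ 𝓢(V, ℂ)) a b
      simp only [FourierTransform.fourierCLM_apply] at this
      rw [this, this]
    have e2 : 𝓕 g ξ = 𝓕 φ (r • ξ) := by
      rw [SchwartzMap.fourier_coe]
      exact aux_fourier_dilate φ hr ξ
    have e3 : 𝓕 f ξ = 𝓕 F ξ := by
      rw [SchwartzMap.fourier_coe]; rfl
    have e4 : (inner ℝ · w : V → ℝ).HasTemperateGrowth := by fun_prop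
    rw [e1, sub_apply, sub_apply, SchwartzMap.fourier_convolution_apply,
      Real.fourier_mul_convolution_eq g.integrable (∂_{w} f).integrable,
      ← SchwartzMap.fourier_coe, ← SchwartzMap.fourier_coe, e2, aux_fourier_shift,
      SchwartzMap.fourier_lineDerivOp_eq, smul_apply,
      SchwartzMap.smulLeftCLM_apply_apply e4, e3]
    simp only [auxM, smul_eq_mul, Complex.real_smul, real_inner_comm w ξ]
    ring
  simp only [← h1]
  rw [← aux_plancherel S]
  simp only [h2, enorm_mul, mul_pow]

/-- gradient side of Plancherel -/
lemma aux_core2 (F : V → ℂ) (hF : ContDiff ℝ (⊤ : ℕ∞) F) (hFc : HasCompactSupport F) (w : V) :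
    ∫⁻ ξ, ENNReal.ofReal ((inner ℝ w ξ) ^ 2) * ‖𝓕 F ξ‖ₑ ^ 2 ≤ ∫⁻ x, ‖fderiv ℝ F x w‖ₑ ^ 2 := by
  set f : 𝓢(V, ℂ) := hFc.toSchwartzMap hF with hf
  have e4 : (inner ℝ · w : V → ℝ).HasTemperateGrowth := by fun_prop
  have h1 : ∀ ξ, 𝓕 (∂_{w} f) ξ = 2 * Real.pi * Complex.I * inner ℝ w ξ * 𝓕 F ξ := by
    intro ξ
    rw [SchwartzMap.fourier_lineDerivOp_eq, smul_apply,
      SchwartzMap.smulLeftCLM_apply_apply e4, SchwartzMap.fourier_coe, real_inner_comm]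
    simp only [smul_eq_mul, Complex.real_smul, mul_assoc]; rfl
  have h2 : ∀ x, fderiv ℝ F x w = ∂_{w} f x := fun x => by
    rw [SchwartzMap.lineDerivOp_apply_eq_fderiv]; rfl
  simp only [h2]
  rw [← aux_plancherel]
  apply lintegral_mono
  intro ξ
  simp only [h1]
  rw [enorm_mul, mul_pow]
  gcongr
  rw [← ofReal_norm, ← ENNReal.ofReal_pow (norm_nonneg _)]
  apply ENNReal.ofReal_le_ofReal
  simp only [norm_mul, Complex.norm_I, Complex.norm_real, mul_pow, Real.norm_eq_abs, sq_abs]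
  have : (1:ℝ) ≤ (‖(2:ℂ)‖ ^ 2 * Real.pi ^ 2 * 1 ^ 2) := by
    simp; nlinarith [Real.pi_gt_three]
  nlinarith [sq_nonneg (inner ℝ w ξ)]

end core
section core2
variable {V : Type*} [NormedAddCommGroup V] [InnerProductSpace ℝ V] [FiniteDimensional ℝ V]
  [MeasurableSpace V] [BorelSpace V]

lemma aux_bounds (φ : V → ℂ) (hφ : ContDiff ℝ (⊤ : ℕ∞) φ) (hφc : HasCompactSupport φ)
    (hint : ∫ x, φ x = 1) :
    Continuous (𝓕 φ) ∧ ∃ K : ℝ, 0 < K ∧ ∀ ξ : V, ‖𝓕 φ ξ‖ ≤ K ∧ ‖ξ‖ * ‖𝓕 φ ξ‖ ≤ K ∧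
      ‖𝓕 φ ξ - 1‖ ≤ K * ‖ξ‖ := by
  set f : 𝓢(V, ℂ) := hφc.toSchwartzMap hφ with hf
  have e : 𝓕 φ = 𝓕 f := by rw [SchwartzMap.fourier_coe]; rfl
  have e0 : 𝓕 f 0 = 1 := by
    rw [← e, Real.fourier_eq]; simpa using hint
  rw [e] at *
  generalize (𝓕 f : 𝓢(V, ℂ)) = g at *
  refine ⟨g.continuous, ?_⟩
  obtain ⟨C0, hC0, h0⟩ := g.decay 0 0
  obtain ⟨C1, hC1, h1⟩ := g.decay 1 0
  obtain ⟨C2, hC2, h2⟩ := g.decay 0 1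
  simp only [pow_zero, one_mul, norm_iteratedFDeriv_zero, pow_one, norm_iteratedFDeriv_one]
    at h0 h1 h2
  refine ⟨C0 + C1 + C2, by positivity, fun ξ => ⟨by linarith [h0 ξ], by linarith [h1 ξ], ?_⟩⟩
  have := Convex.norm_image_sub_le_of_norm_fderiv_le (𝕜 := ℝ) (f := g) (s := univ) (C := C2)
    (fun x _ => g.differentiableAt) (fun x _ => h2 x) convex_univ (mem_univ (0:V)) (mem_univ ξ)
  rw [e0, sub_zero] at this
  nlinarith [norm_nonneg ξ]

lemma aux_exp2 (a : ℝ) : ‖Complex.exp (Complex.I * a) - 1 - Complex.I * a‖ ≤ 2 * a ^ 2 := by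
  by_cases h : |a| ≤ 1
  · have := Complex.norm_exp_sub_one_sub_id_le (x := Complex.I * a) (by simpa using h)
    simp at this
    nlinarith [sq_nonneg a]
  · push Not at h
    have h1 := Real.norm_exp_I_mul_ofReal_sub_one_le (x := a)
    have h2 := norm_sub_le (Complex.exp (Complex.I * a) - 1) (Complex.I * a)
    simp at h2 h1
    nlinarith [sq_abs a]

lemma aux_mult (φ : V → ℂ) {K R : ℝ} (hK : 0 < K) (hR : 0 < R)
    (hb : ∀ ξ : V, ‖𝓕 φ ξ‖ ≤ K ∧ ‖ξ‖ * ‖𝓕 φ ξ‖ ≤ K ∧ ‖𝓕 φ ξ - 1‖ ≤ K * ‖ξ‖)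
    {A D : ℝ} (hA : A = 2 * Real.pi * R) (hD : D = 2 * A ^ 2 + A * K + A + 2)
    (h ξ : V) (hh : ‖h‖ ≤ R) {t B : ℝ} (ht : 0 < t) (hB : 1 ≤ B) :
    ‖auxM φ (B⁻¹ * t) (t • h) ξ‖ ≤ D * (t * ‖ξ‖) ^ 2 ∧
    ‖auxM φ (B⁻¹ * t) (t • h) ξ‖ ≤ D * (t * ‖ξ‖) ∧
    ‖auxM φ (B⁻¹ * t) (t • h) ξ‖ ≤ D * B := by
  have hA0 : 0 < A := by rw [hA]; positivity
  set a : ℝ := 2 * Real.pi * inner ℝ (t • h) ξ with ha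
  set s := t * ‖ξ‖ with hs
  have hs0 : 0 ≤ s := by positivity
  set p := 𝓕 φ ((B⁻¹ * t) • ξ) with hp
  obtain ⟨b1, b2, b3⟩ := hb ((B⁻¹ * t) • ξ)
  have hnorm : ‖(B⁻¹ * t) • ξ‖ = B⁻¹ * s := by
    rw [norm_smul, Real.norm_of_nonneg (by positivity), hs]; ring
  rw [hnorm] at b2 b3
  have hm : auxM φ (B⁻¹ * t) (t • h) ξ = Complex.exp (Complex.I * a) - 1 - Complex.I * a * p := by
    simp only [auxM, ha, hp]
    push_cast
    congr 2
    · rw [mul_comm]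
    · ring
  have ha1 : |a| ≤ A * s := by
    have := abs_real_inner_le_norm (t • h) ξ
    rw [norm_smul, Real.norm_of_nonneg ht.le] at this
    rw [ha, abs_mul, abs_of_pos (by positivity), hA, hs]
    have : |inner ℝ (t • h) ξ| ≤ R * (t * ‖ξ‖) := by
      refine this.trans ?_
      have : ‖h‖ * (t * ‖ξ‖) ≤ R * (t * ‖ξ‖) := by gcongr
      linarith
    calc _ ≤ 2 * Real.pi * (R * (t * ‖ξ‖)) := by gcongr
      _ = _ := by ring
  have hIa : ‖Complex.I * a * p‖ = |a| * ‖p‖ := by simp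
  have hBi : B⁻¹ ≤ 1 := inv_le_one_of_one_le₀ hB
  rw [hm]
  refine ⟨?_, ?_, ?_⟩
  · have e : Complex.exp (Complex.I * a) - 1 - Complex.I * a * p
      = (Complex.exp (Complex.I * a) - 1 - Complex.I * a) - Complex.I * a * (p - 1) := by ring
    rw [e]
    refine (norm_sub_le _ _).trans ?_
    have h1 := aux_exp2 a
    have h2 : ‖Complex.I * a * (p - 1)‖ = |a| * ‖p - 1‖ := by simp
    rw [h2]
    have h3 : |a| * ‖p - 1‖ ≤ (A * s) * (K * s) := by
      gcongr
      refine b3.trans ?_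
      gcongr
      nlinarith
    have h4 : a ^ 2 ≤ (A * s) ^ 2 := by
      rw [← sq_abs]; gcongr
    rw [hD]
    nlinarith [sq_nonneg s, mul_nonneg hA0.le (sq_nonneg s)]
  · refine (norm_sub_le _ _).trans ?_
    rw [hIa]
    have h1 := Real.norm_exp_I_mul_ofReal_sub_one_le (x := a)
    rw [Real.norm_eq_abs] at h1
    have h3 : |a| * ‖p‖ ≤ (A * s) * K := by gcongr
    rw [hD]
    nlinarith [mul_nonneg (sq_nonneg A) hs0]
  · refine (norm_sub_le _ _).trans ?_
    rw [hIa]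
    have h1 : ‖Complex.exp (Complex.I * a) - 1‖ ≤ 2 := by
      refine (norm_sub_le _ _).trans ?_
      rw [mul_comm, Complex.norm_exp_ofReal_mul_I]; norm_num
    have h3 : |a| * ‖p‖ ≤ A * (K * B) := by
      calc |a| * ‖p‖ ≤ (A * s) * ‖p‖ := by gcongr
        _ = A * ((B⁻¹ * s * ‖p‖) * B) := by field_simp
        _ ≤ _ := by gcongr
    rw [hD]
    nlinarith [mul_nonneg (sq_nonneg A) (by linarith : 0 ≤ B)]

lemma aux_tint (u : ℝ → ℝ) {L D : ℝ} (hL : 0 < L) (hD : 0 < D) (k : ℕ) (hk : 1 ≤ k)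
    (h0 : ∀ t, 0 ≤ u t)
    (hu : ∀ t, 0 < t → u t ≤ D * (t * L) ^ 2 ∧ u t ≤ D * (t * L) ∧ u t ≤ D * 2 ^ k) :
    ∫⁻ t in Ioi (0:ℝ), ENNReal.ofReal ((t ^ 3)⁻¹) * ENNReal.ofReal (u t ^ 2)
      ≤ ENNReal.ofReal (3 * D ^ 2 * k * L ^ 2) := by
  set a := L⁻¹ with ha
  set b := 2 ^ k * L⁻¹ with hb
  have ha0 : 0 < a := by positivity
  have hb0 : 0 < b := by positivity
  have h2k : (1:ℝ) ≤ 2 ^ k := one_le_pow₀ (by norm_num)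
  have hab : a ≤ b := by rw [hb]; nlinarith
  have hsplit : Ioi (0:ℝ) = Ioc 0 a ∪ (Ioc a b ∪ Ioi b) := by
    rw [Ioc_union_Ioi_eq_Ioi hab, Ioc_union_Ioi_eq_Ioi ha0.le]
  rw [hsplit]
  have hk1 : (1:ℝ) ≤ k := by exact_mod_cast hk
  have i1 : ∫⁻ t in Ioc 0 a, ENNReal.ofReal ((t ^ 3)⁻¹) * ENNReal.ofReal (u t ^ 2)
      ≤ ENNReal.ofReal (D ^ 2 * L ^ 2) := by
    calc _ ≤ ∫⁻ t in Ioc 0 a, ENNReal.ofReal (D ^ 2 * L ^ 3) := by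
          apply setLIntegral_mono' measurableSet_Ioc
          intro t ht
          rw [← ENNReal.ofReal_mul (by have := ht.1; positivity)]
          apply ENNReal.ofReal_le_ofReal
          have ht0 := ht.1
          have htL : t * L ≤ 1 := by
            have := mul_le_mul_of_nonneg_right ht.2 hL.le
            rwa [ha, inv_mul_cancel₀ hL.ne'] at this
          have := (hu t ht.1).1
          calc (t ^ 3)⁻¹ * u t ^ 2 ≤ (t ^ 3)⁻¹ * (D * (t * L) ^ 2) ^ 2 := by
                gcongr; exact h0 t
            _ = D ^ 2 * L ^ 3 * (t * L) := by field_simp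
            _ ≤ D ^ 2 * L ^ 3 * 1 := by gcongr
            _ = _ := by ring
      _ = _ := by
          rw [setLIntegral_const, Real.volume_Ioc, ← ENNReal.ofReal_mul (by positivity)]
          congr 1
          rw [ha]; field_simp; ring
  have i2 : ∫⁻ t in Ioc a b, ENNReal.ofReal ((t ^ 3)⁻¹) * ENNReal.ofReal (u t ^ 2)
      ≤ ENNReal.ofReal (D ^ 2 * k * L ^ 2) := by
    have hint : ∫ t in a..b, D ^ 2 * L ^ 2 * t⁻¹ = D ^ 2 * L ^ 2 * (k * Real.log 2) := by
      rw [intervalIntegral.integral_const_mul, integral_inv_of_pos ha0 hb0]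
      have : b / a = 2 ^ k := by rw [ha, hb]; field_simp
      rw [this, Real.log_pow]
    rw [intervalIntegral.integral_of_le hab] at hint
    calc _ ≤ ∫⁻ t in Ioc a b, ENNReal.ofReal (D ^ 2 * L ^ 2 * t⁻¹) := by
          apply setLIntegral_mono' measurableSet_Ioc
          intro t ht
          have ht0 : 0 < t := ha0.trans ht.1
          rw [← ENNReal.ofReal_mul (by positivity)]
          apply ENNReal.ofReal_le_ofReal
          have := (hu t ht0).2.1
          calc (t ^ 3)⁻¹ * u t ^ 2 ≤ (t ^ 3)⁻¹ * (D * (t * L)) ^ 2 := by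
                gcongr; exact h0 t
            _ = _ := by field_simp
      _ = ENNReal.ofReal (∫ t in Ioc a b, D ^ 2 * L ^ 2 * t⁻¹) := by
          rw [ofReal_integral_eq_lintegral_ofReal]
          · have : IntervalIntegrable (fun t : ℝ => D ^ 2 * L ^ 2 * t⁻¹) volume a b := by
              apply IntervalIntegrable.const_mul
              apply intervalIntegral.intervalIntegrable_inv
              · intro x hx
                rw [uIcc_of_le hab] at hx
                exact (ha0.trans_le hx.1).ne'
              · exact continuousOn_id
            exact this.1
          · filter_upwards [ae_restrict_mem measurableSet_Ioc] with t ht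
            have ht0 : 0 < t := ha0.trans ht.1
            simp only [Pi.zero_apply]
            positivity
      _ ≤ _ := by
          rw [hint]
          apply ENNReal.ofReal_le_ofReal
          have : Real.log 2 ≤ 1 := by linarith [Real.log_two_lt_d9]
          have h5 : 0 ≤ D ^ 2 * L ^ 2 * k := by positivity
          nlinarith
  have i3 : ∫⁻ t in Ioi b, ENNReal.ofReal ((t ^ 3)⁻¹) * ENNReal.ofReal (u t ^ 2)
      ≤ ENNReal.ofReal (D ^ 2 * L ^ 2) := by
    have hint : ∫ t in Ioi b, (D * 2 ^ k) ^ 2 * t ^ (-3:ℝ) = D ^ 2 * L ^ 2 / 2 := by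
      rw [integral_const_mul, integral_Ioi_rpow_of_lt (by norm_num) hb0]
      have : b ^ ((-3:ℝ) + 1) = (b ^ 2)⁻¹ := by
        rw [show (-3:ℝ) + 1 = -(2:ℕ) by norm_num, Real.rpow_neg hb0.le, Real.rpow_natCast]
      rw [this, hb]; field_simp; norm_num
    calc _ ≤ ∫⁻ t in Ioi b, ENNReal.ofReal ((D * 2 ^ k) ^ 2 * t ^ (-3:ℝ)) := by
          apply setLIntegral_mono' measurableSet_Ioi
          intro t ht
          have ht0 : 0 < t := hb0.trans ht
          rw [← ENNReal.ofReal_mul (by positivity)]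
          apply ENNReal.ofReal_le_ofReal
          have := (hu t ht0).2.2
          have e : t ^ (-3:ℝ) = (t ^ 3)⁻¹ := by
            rw [show (-3:ℝ) = -(3:ℕ) by norm_num, Real.rpow_neg ht0.le, Real.rpow_natCast]
          rw [e]
          calc (t ^ 3)⁻¹ * u t ^ 2 ≤ (t ^ 3)⁻¹ * (D * 2 ^ k) ^ 2 := by
                gcongr; exact h0 t
            _ = _ := by ring
      _ = ENNReal.ofReal (∫ t in Ioi b, (D * 2 ^ k) ^ 2 * t ^ (-3:ℝ)) := by
          rw [ofReal_integral_eq_lintegral_ofReal]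
          · exact (integrableOn_Ioi_rpow_of_lt (by norm_num) hb0).const_mul _
          · filter_upwards [ae_restrict_mem measurableSet_Ioi] with t ht
            have ht0 : 0 < t := hb0.trans ht
            simp only [Pi.zero_apply]
            positivity
      _ ≤ _ := by
          rw [hint]
          apply ENNReal.ofReal_le_ofReal
          have : 0 ≤ D ^ 2 * L ^ 2 := by positivity
          linarith
  refine (lintegral_union_le _ _ _).trans ?_
  refine (add_le_add le_rfl (lintegral_union_le _ _ _)).trans ?_
  refine (add_le_add i1 (add_le_add i2 i3)).trans ?_
  rw [← ENNReal.ofReal_add (by positivity) (by positivity),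
    ← ENNReal.ofReal_add (by positivity) (by positivity)]
  apply ENNReal.ofReal_le_ofReal
  have : 0 ≤ D ^ 2 * L ^ 2 := by positivity
  nlinarith

lemma aux_mtint (φ : V → ℂ) (hφ : ContDiff ℝ (⊤ : ℕ∞) φ) (hφc : HasCompactSupport φ)
    (hint : ∫ x, φ x = 1) {R : ℝ} (hR : 0 < R) :
    ∃ D : ℝ, 0 < D ∧ ∀ h ξ : V, ‖h‖ ≤ R → ∀ k : ℕ, 1 ≤ k →
      ∫⁻ t in Ioi (0:ℝ), ENNReal.ofReal ((t ^ 3)⁻¹)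
        * ‖auxM φ ((2:ℝ) ^ (-(k:ℤ)) * t) (t • h) ξ‖ₑ ^ 2
      ≤ ENNReal.ofReal (D * k * ‖ξ‖ ^ 2) := by
  obtain ⟨_, K, hK, hb⟩ := aux_bounds φ hφ hφc hint
  set A := 2 * Real.pi * R with hA
  set D := 2 * A ^ 2 + A * K + A + 2 with hD
  have hA0 : 0 < A := by rw [hA]; positivity
  have hD0 : 0 < D := by rw [hD]; positivity
  refine ⟨3 * D ^ 2, by positivity, fun h ξ hh k hk => ?_⟩
  by_cases hξ : ξ = 0
  · subst hξ
    simp [auxM]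
  have := aux_tint (fun t => ‖auxM φ ((2:ℝ) ^ (-(k:ℤ)) * t) (t • h) ξ‖) (norm_pos_iff.2 hξ) hD0 k hk
    (fun t => norm_nonneg _) (fun t ht => by
      have := aux_mult φ hK hR hb hA hD h ξ hh ht (B := 2 ^ k) (one_le_pow₀ (by norm_num))
      simpa only [zpow_neg, zpow_natCast] using this)
  refine le_trans (le_of_eq ?_) this
  congr with t
  rw [← ofReal_norm, ENNReal.ofReal_pow (norm_nonneg _)]

end core2

section core3
variable {V : Type*} [NormedAddCommGroup V] [InnerProductSpace ℝ V] [FiniteDimensional ℝ V]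
  [MeasurableSpace V] [BorelSpace V]

lemma aux_core3 (φ : V → ℂ) (hφ : ContDiff ℝ (⊤ : ℕ∞) φ) (hφc : HasCompactSupport φ)
    (hint : ∫ x, φ x = 1) {R : ℝ} (hR : 0 < R) :
    ∃ D : ℝ, 0 < D ∧ ∀ F : V → ℂ, ContDiff ℝ (⊤ : ℕ∞) F → HasCompactSupport F →
      ∀ h : V, ‖h‖ ≤ R → ∀ k : ℕ, 1 ≤ k →
      ∫⁻ t in Ioi (0:ℝ), ENNReal.ofReal ((t ^ 3)⁻¹)
        * ∫⁻ x, ‖F (x + t • h) - F x - ∫ z, (((((2:ℝ) ^ (-(k:ℤ)) * t)⁻¹ ^ Module.finrank ℝ V : ℝ) : ℂ)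
          * φ (((2:ℝ) ^ (-(k:ℤ)) * t)⁻¹ • (x - z))) * fderiv ℝ F z (t • h)‖ₑ ^ 2
      ≤ ENNReal.ofReal (D * k) * ∫⁻ ξ : V, ENNReal.ofReal (‖ξ‖ ^ 2) * ‖𝓕 F ξ‖ₑ ^ 2 := by
  obtain ⟨D, hD, H⟩ := aux_mtint φ hφ hφc hint hR
  have hcφ := (aux_bounds φ hφ hφc hint).1
  refine ⟨D, hD, fun F hF hFc h hh k hk => ?_⟩
  have hcF : Continuous (𝓕 F) := by
    have e : 𝓕 F = 𝓕 (hFc.toSchwartzMap hF) := by rw [SchwartzMap.fourier_coe]; rfl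
    rw [e]
    exact (𝓕 (hFc.toSchwartzMap hF)).continuous
  have hcM : Continuous (fun p : ℝ × V => auxM φ ((2:ℝ) ^ (-(k:ℤ)) * p.1) (p.1 • h) p.2) := by
    unfold auxM
    fun_prop
  calc _ = ∫⁻ t in Ioi (0:ℝ), ∫⁻ ξ : V, ENNReal.ofReal ((t ^ 3)⁻¹)
        * ‖auxM φ ((2:ℝ) ^ (-(k:ℤ)) * t) (t • h) ξ‖ₑ ^ 2 * ‖𝓕 F ξ‖ₑ ^ 2 := by
        apply setLIntegral_congr_fun measurableSet_Ioi
        intro t ht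
        have ht0 : 0 < t := ht
        simp only
        rw [aux_core1 φ F hφ hφc hF hFc (by positivity) (t • h), ← lintegral_const_mul']
        · simp only [mul_assoc]
        · exact ENNReal.ofReal_ne_top
    _ = ∫⁻ ξ : V, ∫⁻ t in Ioi (0:ℝ), ENNReal.ofReal ((t ^ 3)⁻¹)
        * ‖auxM φ ((2:ℝ) ^ (-(k:ℤ)) * t) (t • h) ξ‖ₑ ^ 2 * ‖𝓕 F ξ‖ₑ ^ 2 := by
        apply lintegral_lintegral_swap
        apply Measurable.aemeasurable
        have h1 := hcM.measurable
        have h2 := hcF.measurable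
        simp only [Function.uncurry_def]
        fun_prop
    _ ≤ ∫⁻ ξ : V, ENNReal.ofReal (D * k) * (ENNReal.ofReal (‖ξ‖ ^ 2) * ‖𝓕 F ξ‖ₑ ^ 2) := by
        apply lintegral_mono
        intro ξ
        simp only
        rw [lintegral_mul_const' _ _ (by simp), ← mul_assoc, ← ENNReal.ofReal_mul (by positivity)]
        gcongr
        exact H h ξ hh k hk
    _ = _ := by
        rw [lintegral_const_mul']
        exact ENNReal.ofReal_ne_top

lemma aux_grad {ι : Type*} [Fintype ι] (b : OrthonormalBasis ι ℝ V) (F : V → ℂ)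
    (hF : ContDiff ℝ (⊤ : ℕ∞) F) (hFc : HasCompactSupport F) :
    ∫⁻ ξ : V, ENNReal.ofReal (‖ξ‖ ^ 2) * ‖𝓕 F ξ‖ₑ ^ 2
      ≤ ∑ i, ∫⁻ x, ‖fderiv ℝ F x (b i)‖ₑ ^ 2 := by
  have hcF : Continuous (𝓕 F) := by
    have e : 𝓕 F = 𝓕 (hFc.toSchwartzMap hF) := by rw [SchwartzMap.fourier_coe]; rfl
    rw [e]
    exact (𝓕 (hFc.toSchwartzMap hF)).continuous
  calc _ = ∫⁻ ξ : V, ∑ i, ENNReal.ofReal ((inner ℝ (b i) ξ) ^ 2) * ‖𝓕 F ξ‖ₑ ^ 2 := by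
        congr with ξ
        rw [← Finset.sum_mul, ← ENNReal.ofReal_sum_of_nonneg (fun i _ => sq_nonneg _)]
        congr 2
        have := b.sum_sq_norm_inner_right ξ
        simpa using this.symm
    _ = ∑ i, ∫⁻ ξ : V, ENNReal.ofReal ((inner ℝ (b i) ξ) ^ 2) * ‖𝓕 F ξ‖ₑ ^ 2 := by
        apply lintegral_finsetSum
        intro i _
        have h2 := hcF.measurable
        fun_prop
    _ ≤ _ := Finset.sum_le_sum fun i _ => aux_core2 F hF hFc (b i)

end core3

/-- the difference being squared -/
noncomputable def auxA {n : ℕ} (φ : (Fin n → ℝ) → ℝ) (F : (Fin n → ℝ) → ℂ) (k : ℕ) (t : ℝ)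
    (x h : Fin n → ℝ) : ℂ :=
  F (x + t • h) - F x - ∫ z, (((((2:ℝ) ^ (-(k:ℤ)) * t)⁻¹ ^ n : ℝ) : ℂ)
          * (φ (((2:ℝ) ^ (-(k:ℤ)) * t)⁻¹ • (x - z)) : ℂ)) * fderiv ℝ F z (t • h)

lemma auxA_meas {n : ℕ} (φ : (Fin n → ℝ) → ℝ) (F : (Fin n → ℝ) → ℂ) (k : ℕ)
    (hφ : Continuous φ) (hF : ContDiff ℝ (⊤ : ℕ∞) F) :
    Measurable (fun p : ℝ × (Fin n → ℝ) × (Fin n → ℝ) => auxA φ F k p.1 p.2.1 p.2.2) := by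
  unfold auxA
  have hFm := hF.continuous.measurable
  have hφm := hφ.measurable
  have hd : Continuous (fderiv ℝ F) := hF.continuous_fderiv (by simp)
  have hap : Continuous (fun q : (Fin n → ℝ) × (Fin n → ℝ) => fderiv ℝ F q.1 q.2) :=
    (hd.comp continuous_fst).clm_apply continuous_snd
  have hapm := hap.measurable
  have h3 : Measurable (fun q : (ℝ × (Fin n → ℝ) × (Fin n → ℝ)) × (Fin n → ℝ) =>
      fderiv ℝ F q.2 (q.1.1 • q.1.2.2)) :=
    hapm.comp (g := fun q : (Fin n → ℝ) × (Fin n → ℝ) => fderiv ℝ F q.1 q.2)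
      (f := fun q : (ℝ × (Fin n → ℝ) × (Fin n → ℝ)) × (Fin n → ℝ) => (q.2, q.1.1 • q.1.2.2))
      (by fun_prop)
  have h4 : Measurable (fun q : (ℝ × (Fin n → ℝ) × (Fin n → ℝ)) × (Fin n → ℝ) =>
      (((((2:ℝ) ^ (-(k:ℤ)) * q.1.1)⁻¹ ^ n : ℝ) : ℂ)
          * (φ (((2:ℝ) ^ (-(k:ℤ)) * q.1.1)⁻¹ • (q.1.2.1 - q.2)) : ℂ))
          * fderiv ℝ F q.2 (q.1.1 • q.1.2.2)) := by
    fun_prop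
  have h5 := h4.stronglyMeasurable.integral_prod_right' (ν := volume)
  have h6 := h5.measurable
  fun_prop

lemma aux_core4 {n : ℕ} (φ : (Fin n → ℝ) → ℝ) (hφ : ContDiff ℝ (⊤ : ℕ∞) φ)
    (hφc : HasCompactSupport φ) (hint : ∫ x, φ x = 1) {c : ℝ} (hc : 0 < c) :
    ∃ D : ℝ, 0 < D ∧ ∀ F : (Fin n → ℝ) → ℂ, ContDiff ℝ (⊤ : ℕ∞) F → HasCompactSupport F →
      ∀ h : Fin n → ℝ, ‖h‖ ≤ c → ∀ k : ℕ, 1 ≤ k →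
      ∫⁻ t in Ioi (0:ℝ), ENNReal.ofReal ((t ^ 3)⁻¹) * ∫⁻ x, ‖auxA φ F k t x h‖ₑ ^ 2
      ≤ ENNReal.ofReal (D * k) * ∫⁻ x, ‖fderiv ℝ F x‖ₑ ^ 2 := by
  set L : EuclideanSpace ℝ (Fin n) ≃L[ℝ] (Fin n → ℝ) := EuclideanSpace.equiv (Fin n) ℝ with hL
  have hmp : MeasurePreserving L := PiLp.volume_preserving_ofLp (Fin n)
  have hme : MeasurableEmbedding L := L.toHomeomorph.measurableEmbedding
  set φ' : EuclideanSpace ℝ (Fin n) → ℂ := fun x => (φ (L x) : ℂ) with hφ'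
  have hφ's : ContDiff ℝ (⊤ : ℕ∞) φ' := Complex.ofRealCLM.contDiff.comp (hφ.comp L.contDiff)
  have hφ'c : HasCompactSupport φ' :=
    (hφc.comp_homeomorph L.toHomeomorph).comp_left (g := fun r : ℝ => (r : ℂ)) (by simp)
  have hint' : ∫ x, φ' x = 1 := by
    have := hmp.integral_comp hme (fun x => (φ x : ℂ))
    rw [hφ', this, integral_complex_ofReal, hint]; simp
  obtain ⟨D, hD, H⟩ := aux_core3 φ' hφ's hφ'c hint'
    (R := ‖(L.symm : (Fin n → ℝ) →L[ℝ] EuclideanSpace ℝ (Fin n))‖ * c + 1) (by positivity)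
  refine ⟨D * (n + 1), by positivity, fun F hF hFc h hh k hk => ?_⟩
  have hF's : ContDiff ℝ (⊤ : ℕ∞) (F ∘ L) := hF.comp L.contDiff
  have hF'c : HasCompactSupport (F ∘ L) := hFc.comp_homeomorph L.toHomeomorph
  have hfd : ∀ x w, fderiv ℝ (F ∘ L) x w = fderiv ℝ F (L x) (L w) := by
    intro x w
    rw [ContinuousLinearEquiv.comp_right_fderiv]; rfl
  have h1 := H (F ∘ L) hF's hF'c (L.symm h) (by
    have := (L.symm : (Fin n → ℝ) →L[ℝ] EuclideanSpace ℝ (Fin n)).le_opNorm h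
    have h2 : ‖(L.symm : (Fin n → ℝ) →L[ℝ] EuclideanSpace ℝ (Fin n))‖ * ‖h‖
      ≤ ‖(L.symm : (Fin n → ℝ) →L[ℝ] EuclideanSpace ℝ (Fin n))‖ * c := by gcongr
    have h3 : ‖L.symm h‖ ≤ _ := this
    linarith) k hk
  have h2 := aux_grad (EuclideanSpace.basisFun (Fin n) ℝ) (F ∘ L) hF's hF'c
  have h3 : ∑ i, ∫⁻ x, ‖fderiv ℝ (F ∘ L) x (EuclideanSpace.basisFun (Fin n) ℝ i)‖ₑ ^ 2
      ≤ ENNReal.ofReal (n + 1) * ∫⁻ x, ‖fderiv ℝ F x‖ₑ ^ 2 := by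
    calc _ ≤ ∑ i : Fin n, ∫⁻ x, ‖fderiv ℝ F x‖ₑ ^ 2 := by
          apply Finset.sum_le_sum
          intro i _
          rw [← hmp.lintegral_comp_emb hme]
          apply lintegral_mono
          intro x
          simp only [hfd]
          gcongr
          refine (ContinuousLinearMap.le_opENorm _ _).trans ?_
          have : ‖L (EuclideanSpace.basisFun (Fin n) ℝ i)‖ₑ ≤ 1 := by
            rw [← ofReal_norm]
            apply ENNReal.ofReal_le_one.2
            rw [pi_norm_le_iff_of_nonneg zero_le_one]
            intro j
            simp only [hL, EuclideanSpace.basisFun_apply, PiLp.coe_continuousLinearEquiv,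
              EuclideanSpace.single]
            by_cases hij : j = i
            · subst hij; simp
            · simp [hij]
          calc _ ≤ ‖fderiv ℝ F (L x)‖ₑ * 1 := by gcongr
            _ = _ := mul_one _
      _ ≤ _ := by
          rw [Finset.sum_const, nsmul_eq_mul]
          gcongr
          rw [Finset.card_univ, Fintype.card_fin, ← ENNReal.ofReal_natCast]
          apply ENNReal.ofReal_le_ofReal
          linarith
  have h4 : ∀ t, ∫⁻ x, ‖auxA φ F k t x h‖ₑ ^ 2 = ∫⁻ x, ‖(F ∘ L) (x + t • L.symm h) - (F ∘ L) x
      - ∫ z, (((((2:ℝ) ^ (-(k:ℤ)) * t)⁻¹ ^ Module.finrank ℝ (EuclideanSpace ℝ (Fin n)) : ℝ) : ℂ)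
          * φ' (((2:ℝ) ^ (-(k:ℤ)) * t)⁻¹ • (x - z))) * fderiv ℝ (F ∘ L) z (t • L.symm h)‖ₑ ^ 2 := by
    intro t
    rw [← hmp.lintegral_comp_emb hme]
    congr with x
    congr 2
    unfold auxA
    rw [← hmp.integral_comp hme]
    simp only [hfd, hφ', Function.comp_apply, map_add, map_smul, map_sub,
      ContinuousLinearEquiv.apply_symm_apply, finrank_euclideanSpace, Fintype.card_fin]
  simp only [h4]
  refine h1.trans ((mul_le_mul_right (h2.trans h3) _).trans (le_of_eq ?_))
  rw [← mul_assoc, ← ENNReal.ofReal_mul (by positivity)]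
  congr 2
  ring

open scoped Pointwise in
lemma aux_avg {n : ℕ} (f : (Fin n → ℝ) → ℝ) (x : Fin n → ℝ) {c t : ℝ} (hc : 0 < c) (ht : 0 < t) :
    ‖⨍ y in Metric.ball x (c * t), f y‖ₑ ≤ (volume (Metric.ball (0 : Fin n → ℝ) c))⁻¹ *
      ∫⁻ h in Metric.ball (0 : Fin n → ℝ) c, ‖f (x + t • h)‖ₑ := by
  have hvol : volume (Metric.ball x (c * t))
      = ENNReal.ofReal (t ^ n) * volume (Metric.ball (0 : Fin n → ℝ) c) := by
    rw [mul_comm c t, Measure.addHaar_ball_mul_of_pos _ _ ht]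
    simp
  have hb0 : volume (Metric.ball (0 : Fin n → ℝ) c) ≠ 0 := (Metric.measure_ball_pos _ _ hc).ne'
  have hbt : volume (Metric.ball (0 : Fin n → ℝ) c) ≠ ⊤ := measure_ball_lt_top.ne
  have h1 : ∫ y in Metric.ball x (c * t), f y
      = t ^ n • ∫ h in Metric.ball (0 : Fin n → ℝ) c, f (x + t • h) := by
    have e1 := Measure.setIntegral_comp_smul_of_pos volume (fun y => f (x + y))
      (Metric.ball (0 : Fin n → ℝ) c) ht
    have e2 : t • Metric.ball (0 : Fin n → ℝ) c = Metric.ball 0 (c * t) := by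
      rw [_root_.smul_ball ht.ne', smul_zero, Real.norm_of_nonneg ht.le, mul_comm]
    have e3 : ∫ y in Metric.ball (0 : Fin n → ℝ) (c * t), f (x + y)
        = ∫ y in Metric.ball x (c * t), f y := by
      have := (measurePreserving_add_left volume x).setIntegral_preimage_emb
        (measurableEmbedding_addLeft x) f (Metric.ball x (c * t))
      rw [← this]
      congr 2
      ext y
      simp
    rw [e1, e2, e3, smul_smul]
    simp only [Module.finrank_fintype_fun_eq_card, Fintype.card_fin]
    rw [mul_inv_cancel₀ (by positivity), one_smul]
  rw [setAverage_eq, h1, smul_smul, enorm_smul]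
  refine mul_le_mul' (le_of_eq ?_) (enorm_integral_le_lintegral_enorm _)
  rw [measureReal_def, hvol, ENNReal.toReal_mul, ENNReal.toReal_ofReal (by positivity)]
  have hr : 0 < (volume (Metric.ball (0 : Fin n → ℝ) c)).toReal := ENNReal.toReal_pos hb0 hbt
  have : (t ^ n * (volume (Metric.ball (0 : Fin n → ℝ) c)).toReal)⁻¹ * t ^ n
      = (volume (Metric.ball (0 : Fin n → ℝ) c)).toReal⁻¹ := by field_simp
  rw [this, Real.enorm_of_nonneg (by positivity), ENNReal.ofReal_inv_of_pos hr,
    ENNReal.ofReal_toReal hbt]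

lemma auxA_eq {n : ℕ} (φ : (Fin n → ℝ) → ℝ) (hφ : Continuous φ) (F : (Fin n → ℝ) → ℂ)
    (hF : ContDiff ℝ (⊤ : ℕ∞) F) (hFc : HasCompactSupport F) (k : ℕ) (t : ℝ)
    (x h : Fin n → ℝ) :
    F (x + t • h) - F x -
      (∫ z, ((((2:ℝ) ^ (-(k:ℤ)) * t)⁻¹ ^ n *
          φ ((((2:ℝ) ^ (-(k:ℤ)) * t)⁻¹) • (x - z))) • fderiv ℝ F z)) (x + t • h - x)
      = auxA φ F k t x h := by
  have hd : Continuous (fderiv ℝ F) := hF.continuous_fderiv (by simp)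
  have hi : Integrable (fun z => (((2:ℝ) ^ (-(k:ℤ)) * t)⁻¹ ^ n *
          φ ((((2:ℝ) ^ (-(k:ℤ)) * t)⁻¹) • (x - z))) • fderiv ℝ F z) := by
    apply Continuous.integrable_of_hasCompactSupport
    · have h1 : Continuous (fun z : Fin n → ℝ => ((2:ℝ) ^ (-(k:ℤ)) * t)⁻¹ ^ n *
          φ ((((2:ℝ) ^ (-(k:ℤ)) * t)⁻¹) • (x - z))) :=
        by fun_prop
      exact h1.smul hd
    · refine (hFc.fderiv (𝕜 := ℝ)).mono ?_
      intro z hz hz'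
      apply hz
      simp only [hz']
      ext w; simp
  rw [add_sub_cancel_left, ContinuousLinearMap.integral_apply hi]
  unfold auxA
  congr 1
  congr with z
  simp
  ring

/-- The square function bound `∫₀^∞∫ β_k(x,t)² dx dt/t ≤ C k ‖∇F‖²`, where
`β_k(x,t)² = ⨍_{|x−y|≤ct} |F(y) − F(x) − (y−x)·P_{2^{-k}t}(∇F)(x)|²/t² dy`. -/
theorem stmt4 {n : ℕ} (hn : 1 ≤ n) (c : ℝ) (hc : 0 < c)
    (φ : (Fin n → ℝ) → ℝ)
    (hsm : ContDiff ℝ (⊤ : ℕ∞) φ)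
    (hsupp : tsupport φ ⊆ Metric.ball 0 1)
    (hint : ∫ x, φ x = 1) :
    ∃ C : ℝ, 0 < C ∧
      ∀ (F : (Fin n → ℝ) → ℂ), ContDiff ℝ (⊤ : ℕ∞) F → HasCompactSupport F →
      ∀ k : ℕ, 1 ≤ k →
      (∫ t in Ioi (0:ℝ),
          (∫ x, ⨍ y in Metric.ball x (c * t),
              ‖F y - F x -
                (∫ z, ((((2:ℝ) ^ (-(k:ℤ)) * t)⁻¹ ^ n *
                    φ ((((2:ℝ) ^ (-(k:ℤ)) * t)⁻¹) • (x - z))) • fderiv ℝ F z)) (y - x)‖ ^ 2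
                / t ^ 2) / t)
        ≤ C * k * ∫ x, ‖fderiv ℝ F x‖ ^ 2 := by
  have hφc : HasCompactSupport φ :=
    HasCompactSupport.of_support_subset_isCompact (isCompact_closedBall (0 : Fin n → ℝ) 1)
      ((subset_tsupport φ).trans (hsupp.trans Metric.ball_subset_closedBall))
  obtain ⟨C, hC, H⟩ := aux_core4 φ hsm hφc hint hc
  refine ⟨C, hC, fun F hF hFc k hk => ?_⟩
  have hd : Continuous (fderiv ℝ F) := hF.continuous_fderiv (by simp)
  have hgrad : ∫⁻ x, ‖fderiv ℝ F x‖ₑ ^ 2 = ENNReal.ofReal (∫ x, ‖fderiv ℝ F x‖ ^ 2) := by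
    rw [ofReal_integral_eq_lintegral_ofReal]
    · congr with x
      rw [← ofReal_norm, ENNReal.ofReal_pow (norm_nonneg _)]
    · apply Continuous.integrable_of_hasCompactSupport (by fun_prop)
      exact (hFc.fderiv (𝕜 := ℝ)).comp_left (g := fun w => ‖w‖ ^ 2) (by simp)
    · exact Filter.Eventually.of_forall fun x => by positivity
  have hgn : 0 ≤ ∫ x, ‖fderiv ℝ F x‖ ^ 2 := integral_nonneg fun x => by positivity
  rw [← ENNReal.ofReal_le_ofReal_iff (by positivity), ENNReal.ofReal_mul (by positivity), ← hgrad]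
  set v := volume (Metric.ball (0 : Fin n → ℝ) c) with hv
  have hb0 : v ≠ 0 := (Metric.measure_ball_pos _ _ hc).ne'
  have hbt : v ≠ ⊤ := measure_ball_lt_top.ne
  have hAm := auxA_meas φ F k hsm.continuous hF
  have hpt : ∀ t : ℝ, 0 < t → ‖(∫ x, ⨍ y in Metric.ball x (c * t),
              ‖F y - F x -
                (∫ z, ((((2:ℝ) ^ (-(k:ℤ)) * t)⁻¹ ^ n *
                    φ ((((2:ℝ) ^ (-(k:ℤ)) * t)⁻¹) • (x - z))) • fderiv ℝ F z)) (y - x)‖ ^ 2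
                / t ^ 2) / t‖ₑ ≤ ∫⁻ h in Metric.ball (0 : Fin n → ℝ) c,
          v⁻¹ * (ENNReal.ofReal ((t ^ 3)⁻¹) * ∫⁻ x, ‖auxA φ F k t x h‖ₑ ^ 2) := by
    intro t ht
    have hswap : ∫⁻ x, ∫⁻ h in Metric.ball (0 : Fin n → ℝ) c, ‖auxA φ F k t x h‖ₑ ^ 2
        = ∫⁻ h in Metric.ball (0 : Fin n → ℝ) c, ∫⁻ x, ‖auxA φ F k t x h‖ₑ ^ 2 := by
      apply lintegral_lintegral_swap
      apply Measurable.aemeasurable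
      have : Measurable (fun q : (Fin n → ℝ) × (Fin n → ℝ) => auxA φ F k t q.1 q.2) :=
        hAm.comp (f := fun q : (Fin n → ℝ) × (Fin n → ℝ) => (t, q.1, q.2)) (by fun_prop)
      simp only [Function.uncurry_def]
      fun_prop
    rw [div_eq_mul_inv, enorm_mul, Real.enorm_of_nonneg (by positivity : 0 ≤ t⁻¹)]
    calc _ ≤ (∫⁻ x, v⁻¹ * ∫⁻ h in Metric.ball (0 : Fin n → ℝ) c,
              ENNReal.ofReal ((t ^ 2)⁻¹) * ‖auxA φ F k t x h‖ₑ ^ 2) * ENNReal.ofReal t⁻¹ := by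
          gcongr
          refine (enorm_integral_le_lintegral_enorm _).trans ?_
          apply lintegral_mono
          intro x
          refine (aux_avg _ x hc ht).trans (le_of_eq ?_)
          congr with h
          rw [auxA_eq φ hsm.continuous F hF hFc, div_eq_mul_inv, enorm_mul,
            Real.enorm_of_nonneg (by positivity : 0 ≤ (t ^ 2)⁻¹), enorm_pow, enorm_norm, mul_comm]
      _ = v⁻¹ * (ENNReal.ofReal ((t ^ 3)⁻¹) *
            ∫⁻ x, ∫⁻ h in Metric.ball (0 : Fin n → ℝ) c, ‖auxA φ F k t x h‖ₑ ^ 2) := by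
          rw [lintegral_const_mul' _ _ (by simpa using hb0)]
          simp only [lintegral_const_mul' _ _ (ENNReal.ofReal_ne_top (r := (t ^ 2)⁻¹))]
          have : ENNReal.ofReal ((t ^ 3)⁻¹) = ENNReal.ofReal ((t ^ 2)⁻¹) * ENNReal.ofReal t⁻¹ := by
            rw [← ENNReal.ofReal_mul (by positivity)]
            congr 1
            field_simp
          rw [this]
          ring
      _ = _ := by
          rw [hswap, lintegral_const_mul' _ _ (by simpa using hb0),
            lintegral_const_mul' _ _ ENNReal.ofReal_ne_top]
  refine (Real.ofReal_le_enorm _).trans ((enorm_integral_le_lintegral_enorm _).trans ?_)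
  refine (setLIntegral_mono' measurableSet_Ioi (fun t ht => hpt t ht)).trans ?_
  have hswap2 : ∫⁻ t in Ioi (0:ℝ), ∫⁻ h in Metric.ball (0 : Fin n → ℝ) c,
          v⁻¹ * (ENNReal.ofReal ((t ^ 3)⁻¹) * ∫⁻ x, ‖auxA φ F k t x h‖ₑ ^ 2)
      = ∫⁻ h in Metric.ball (0 : Fin n → ℝ) c, ∫⁻ t in Ioi (0:ℝ),
          v⁻¹ * (ENNReal.ofReal ((t ^ 3)⁻¹) * ∫⁻ x, ‖auxA φ F k t x h‖ₑ ^ 2) := by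
    apply lintegral_lintegral_swap
    apply Measurable.aemeasurable
    have h1 : Measurable (fun q : (ℝ × (Fin n → ℝ)) × (Fin n → ℝ) =>
        ‖auxA φ F k q.1.1 q.2 q.1.2‖ₑ ^ 2) := by
      have : Measurable (fun q : (ℝ × (Fin n → ℝ)) × (Fin n → ℝ) => auxA φ F k q.1.1 q.2 q.1.2) :=
        hAm.comp (f := fun q : (ℝ × (Fin n → ℝ)) × (Fin n → ℝ) => (q.1.1, q.2, q.1.2))
          (by fun_prop)
      fun_prop
    have h2 := h1.lintegral_prod_right' (ν := volume)
    simp only [Function.uncurry_def]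
    fun_prop
  rw [hswap2]
  calc _ ≤ ∫⁻ h in Metric.ball (0 : Fin n → ℝ) c,
        v⁻¹ * (ENNReal.ofReal (C * k) * ∫⁻ x, ‖fderiv ℝ F x‖ₑ ^ 2) := by
        apply setLIntegral_mono' Metric.isOpen_ball.measurableSet
        intro h hh
        rw [lintegral_const_mul' _ _ (by simpa using hb0)]
        gcongr
        exact H F hF hFc h (by simpa using (mem_ball_zero_iff.1 hh).le) k hk
    _ = _ := by
        rw [setLIntegral_const, mul_comm, ← mul_assoc, ENNReal.mul_inv_cancel hb0 hbt, one_mul]
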